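/- arXiv:1606.05303 — 7 statements merged into one kernel-verified Lean document; each statement's English description precedes it below -/
import Mathlib

section
/- For all integers m, n, t with m, n, t ≤ -1 and not all three equal to -1, the Q(m,n,t)-system has exactly two solutions (a, b, c) in nonzero real numbers; in one of these solutions a < -1, b < -1 and c < -1, and in the other -1 < a < 0, -1 < b < 0 and -1 < c < 0. -/
/-- A triple `(a, b, c)` of nonzero real numbers is a solution of the `Q(m,n,t)`-system
if `1 + a + 1/b = m`, `1 + b + 1/c = n` and `1 + c + 1/a = t`. -/
def QSystem (m n t : ℤ) (a b c : ℝ) : Prop :=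
  a ≠ 0 ∧ b ≠ 0 ∧ c ≠ 0 ∧
  1 + a + 1 / b = (m : ℝ) ∧ 1 + b + 1 / c = (n : ℝ) ∧ 1 + c + 1 / a = (t : ℝ)

/-- A quadratic with positive leading and constant coefficients which is negative at `1` has
exactly two real roots, one in `(0, 1)` and one in `(1, ∞)`. -/
theorem exists_roots_of_neg_at_one {A B C : ℝ} (hA : 0 < A) (hC : 0 < C) (h : A - B + C < 0) :
    ∃ x₁ x₂ : ℝ, 1 < x₁ ∧ 0 < x₂ ∧ x₂ < 1 ∧
      ∀ x : ℝ, A * x ^ 2 - B * x + C = 0 ↔ x = x₁ ∨ x = x₂ := by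
  have hAC : 0 < A * C := mul_pos hA hC
  have hD : 0 < B ^ 2 - 4 * A * C := by nlinarith [sq_nonneg (A - C)]
  have hs : √(B ^ 2 - 4 * A * C) ^ 2 = B ^ 2 - 4 * A * C := Real.sq_sqrt hD.le
  have hs0 : 0 < √(B ^ 2 - 4 * A * C) := Real.sqrt_pos.2 hD
  generalize √(B ^ 2 - 4 * A * C) = s at hs hs0
  have hAh : 0 < A * (B - A - C) := mul_pos hA (by linarith)
  have habs : |2 * A - B| < s := abs_lt_of_sq_lt_sq (by nlinarith) hs0.le
  obtain ⟨h1, h2⟩ := abs_lt.1 habs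
  have hsB : s < B := lt_of_pow_lt_pow_left₀ 2 (by linarith) (by nlinarith)
  refine ⟨(B + s) / (2 * A), (B - s) / (2 * A), ?_, ?_, ?_, fun x => ?_⟩
  · rw [lt_div_iff₀ (by positivity)]; linarith
  · exact div_pos (by linarith) (by positivity)
  · rw [div_lt_one (by positivity)]; linarith
  · rw [eq_div_iff (by positivity), eq_div_iff (by positivity), ← sub_eq_zero (b := B + s),
      ← sub_eq_zero (b := B - s), ← mul_eq_zero]
    have key : (x * (2 * A) - (B + s)) * (x * (2 * A) - (B - s))
        = 4 * A * (A * x ^ 2 - B * x + C) := by linear_combination -hs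
    rw [key, mul_eq_zero]
    simp [hA.ne']

/-- The first coordinate of a solution of `x + 1/y = p`, `y + 1/z = q`, `z + 1/x = r` is a root
of an explicit quadratic. -/
theorem quadratic_of_cyclic_system {p q r x y z : ℝ} (hx : x ≠ 0) (hy : y ≠ 0) (hz : z ≠ 0)
    (h₁ : x + 1 / y = p) (h₂ : y + 1 / z = q) (h₃ : z + 1 / x = r) :
    (q * r - 1) * x ^ 2 - (p * q * r + q - p - r) * x + (p * q - 1) = 0 := by
  subst h₁ h₂ h₃
  field_simp
  ring

/-- A root of the quadratic which is greater than `1` extends to a solution of the cyclic system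
with all coordinates greater than `1`. -/
theorem exists_cyclic_system_of_one_lt {p q r x : ℝ} (hq : 2 ≤ q) (hr : 2 ≤ r) (hx : 1 < x)
    (h : (q * r - 1) * x ^ 2 - (p * q * r + q - p - r) * x + (p * q - 1) = 0) :
    ∃ y z : ℝ, 1 < y ∧ 1 < z ∧ x + 1 / y = p ∧ y + 1 / z = q ∧ z + 1 / x = r := by
  have hx' : 1 / x < 1 := (div_lt_one (by linarith)).2 hx
  obtain ⟨z, hz⟩ : ∃ z, z = r - 1 / x := ⟨_, rfl⟩
  have hz1 : 1 < z := by linarith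
  have hz' : 1 / z < 1 := (div_lt_one (by linarith)).2 hz1
  obtain ⟨y, hy⟩ : ∃ y, y = q - 1 / z := ⟨_, rfl⟩
  have hy1 : 1 < y := by linarith
  refine ⟨y, z, hy1, hz1, ?_, by linarith, by linarith⟩
  have ezx : z * x = r * x - 1 := by rw [hz]; field_simp
  have eyz : y * z = q * z - 1 := by rw [hy]; field_simp
  have hxz : x * z ≠ 0 := by positivity
  have key : x * z * ((p - x) * y - 1) = 0 := by
    linear_combination (p - x) * x * eyz + ((p - x) * q - 1) * ezx - h
  have hxy : (p - x) * y - 1 = 0 := (mul_eq_zero.1 key).resolve_left hxz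
  field_simp
  linarith

/-- A root of the quadratic in `(0, 1)` extends to a solution of the cyclic system with all
coordinates in `(0, 1)`. -/
theorem exists_cyclic_system_of_lt_one {p q r x : ℝ} (hp : 2 ≤ p) (hq : 2 ≤ q) (hx0 : 0 < x)
    (hx : x < 1)
    (h : (q * r - 1) * x ^ 2 - (p * q * r + q - p - r) * x + (p * q - 1) = 0) :
    ∃ y z : ℝ, (0 < y ∧ y < 1) ∧ (0 < z ∧ z < 1) ∧
      x + 1 / y = p ∧ y + 1 / z = q ∧ z + 1 / x = r := by
  have hpx : 1 < p - x := by linarith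
  obtain ⟨y, hy⟩ : ∃ y, y = 1 / (p - x) := ⟨_, rfl⟩
  have hy0 : 0 < y := by rw [hy]; exact one_div_pos.2 (by linarith)
  have hy1 : y < 1 := by rw [hy]; exact (div_lt_one (by linarith)).2 hpx
  have hqy : 1 < q - y := by linarith
  obtain ⟨z, hz⟩ : ∃ z, z = 1 / (q - y) := ⟨_, rfl⟩
  have hz0 : 0 < z := by rw [hz]; exact one_div_pos.2 (by linarith)
  have hz1 : z < 1 := by rw [hz]; exact (div_lt_one (by linarith)).2 hqy
  refine ⟨y, z, ⟨hy0, hy1⟩, ⟨hz0, hz1⟩, by rw [hy, one_div_one_div]; ring,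
    by rw [hz, one_div_one_div]; ring, ?_⟩
  have ey : y * (p - x) = 1 := by rw [hy, one_div_mul_cancel (by linarith)]
  have ez : z * (q - y) = 1 := by rw [hz, one_div_mul_cancel (by linarith)]
  have hne : (p - x) * (q - y) ≠ 0 := mul_ne_zero (by linarith) (by linarith)
  have key : (p - x) * (q - y) * ((r - z) * x - 1) = 0 := by
    linear_combination -h - (p - x) * x * ez - (r * x - 1) * ey
  have hzx : (r - z) * x - 1 = 0 := (mul_eq_zero.1 key).resolve_left hne
  field_simp
  linarith

/-- In terms of `x = -a`, `y = -b`, `z = -c`, the `Q(m,n,t)`-system is cyclic in `1 - m`, `1 - n`,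
`1 - t`. -/
theorem qSystem_neg_iff {m n t : ℤ} {x y z : ℝ} :
    QSystem m n t (-x) (-y) (-z) ↔ x ≠ 0 ∧ y ≠ 0 ∧ z ≠ 0 ∧
      x + 1 / y = 1 - m ∧ y + 1 / z = 1 - n ∧ z + 1 / x = 1 - t := by
  simp only [QSystem, neg_ne_zero, div_neg]
  refine and_congr_right fun _ => and_congr_right fun _ => and_congr_right fun _ =>
    and_congr ?_ (and_congr ?_ ?_) <;> constructor <;> intro h <;> linarith

/-- A solution of the `Q(m,n,t)`-system is determined by its first coordinate. -/
theorem QSystem.eq_of_fst_eq {m n t : ℤ} {a b c b' c' : ℝ} (h : QSystem m n t a b c)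
    (h' : QSystem m n t a b' c') : b = b' ∧ c = c' := by
  obtain ⟨-, -, -, h₁, -, h₃⟩ := h
  obtain ⟨-, -, -, h₁', -, h₃'⟩ := h'
  have hb : 1 / b = 1 / b' := by linarith
  exact ⟨by simpa using hb, by linarith⟩

/-- For integers `m, n, t ≤ -1`, not all equal to `-1`, the `Q(m,n,t)`-system has exactly
two solutions in nonzero reals: one with `a, b, c < -1` and one with `-1 < a, b, c < 0`. -/
theorem Q_system_two_solutions (m n t : ℤ) (hm : m ≤ -1) (hn : n ≤ -1) (ht : t ≤ -1)
    (hne : ¬(m = -1 ∧ n = -1 ∧ t = -1)) :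
    ∃ s₁ s₂ : ℝ × ℝ × ℝ, s₁ ≠ s₂ ∧
      QSystem m n t s₁.1 s₁.2.1 s₁.2.2 ∧ QSystem m n t s₂.1 s₂.2.1 s₂.2.2 ∧
      (∀ s : ℝ × ℝ × ℝ, QSystem m n t s.1 s.2.1 s.2.2 → s = s₁ ∨ s = s₂) ∧
      (s₁.1 < -1 ∧ s₁.2.1 < -1 ∧ s₁.2.2 < -1) ∧
      ((-1 < s₂.1 ∧ s₂.1 < 0) ∧ (-1 < s₂.2.1 ∧ s₂.2.1 < 0) ∧ (-1 < s₂.2.2 ∧ s₂.2.2 < 0)) := by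
  have hp : (2 : ℝ) ≤ 1 - m := by
    have : (m : ℝ) ≤ -1 := mod_cast hm
    linarith
  have hq : (2 : ℝ) ≤ 1 - n := by
    have : (n : ℝ) ≤ -1 := mod_cast hn
    linarith
  have hr : (2 : ℝ) ≤ 1 - t := by
    have : (t : ℝ) ≤ -1 := mod_cast ht
    linarith
  have hne' : 0 < (1 - n) * (-m) * (-t) - (-m) - (-t) := by
    by_contra! hle
    have h₁ : 0 ≤ (-1 - n) * (m * t) := mul_nonneg (by linarith) (by nlinarith)
    have h₂ : 0 ≤ (-1 - m) * (-t) := mul_nonneg (by linarith) (by linarith)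
    have h₃ : 0 ≤ (-1 - t) * (-m) := mul_nonneg (by linarith) (by linarith)
    have hm' : m = -1 := by nlinarith
    have ht' : t = -1 := by nlinarith
    subst hm' ht'
    exact hne ⟨rfl, by linarith, rfl⟩
  have hneg : (0 : ℝ) < (1 - n) * (-m) * (-t) - (-m) - (-t) := mod_cast hne'
  obtain ⟨p, hp'⟩ : ∃ p : ℝ, p = 1 - m := ⟨_, rfl⟩
  obtain ⟨q, hq'⟩ : ∃ q : ℝ, q = 1 - n := ⟨_, rfl⟩
  obtain ⟨r, hr'⟩ : ∃ r : ℝ, r = 1 - t := ⟨_, rfl⟩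
  rw [← hp'] at hp
  rw [← hq'] at hq
  rw [← hr'] at hr
  obtain ⟨x₁, x₂, hx₁, hx₂, hx₂', hroot⟩ := exists_roots_of_neg_at_one
    (A := q * r - 1) (B := p * q * r + q - p - r) (C := p * q - 1)
    (by nlinarith) (by nlinarith) (by rw [hp', hq', hr']; linarith)
  obtain ⟨y₁, z₁, hy₁, hz₁, e₁⟩ :=
    exists_cyclic_system_of_one_lt hq hr hx₁ ((hroot x₁).2 (.inl rfl))
  obtain ⟨y₂, z₂, ⟨hy₂, hy₂'⟩, ⟨hz₂, hz₂'⟩, e₂⟩ :=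
    exists_cyclic_system_of_lt_one hp hq hx₂ hx₂' ((hroot x₂).2 (.inr rfl))
  rw [hp', hq', hr'] at e₁ e₂
  have s₁ : QSystem m n t (-x₁) (-y₁) (-z₁) :=
    qSystem_neg_iff.2 ⟨by positivity, by positivity, by positivity, e₁⟩
  have s₂ : QSystem m n t (-x₂) (-y₂) (-z₂) :=
    qSystem_neg_iff.2 ⟨by positivity, by positivity, by positivity, e₂⟩
  refine ⟨(-x₁, -y₁, -z₁), (-x₂, -y₂, -z₂), fun h => ?_, s₁, s₂, ?_,
    ⟨by linarith, by linarith, by linarith⟩,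
    ⟨by linarith, by linarith⟩, ⟨by linarith, by linarith⟩, ⟨by linarith, by linarith⟩⟩
  · have : -x₁ = -x₂ := congrArg Prod.fst h
    linarith
  · rintro ⟨a, b, c⟩ h
    obtain ⟨ha, hb, hc, e⟩ := qSystem_neg_iff (x := -a) (y := -b) (z := -c) |>.1 (by simpa using h)
    rw [← hp', ← hq', ← hr'] at e
    rcases (hroot (-a)).1 (quadratic_of_cyclic_system ha hb hc e.1 e.2.1 e.2.2) with hx | hx
    · obtain rfl : a = -x₁ := by linarith
      obtain ⟨rfl, rfl⟩ := h.eq_of_fst_eq s₁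
      exact .inl rfl
    · obtain rfl : a = -x₂ := by linarith
      obtain ⟨rfl, rfl⟩ := h.eq_of_fst_eq s₂
      exact .inr rfl
end

section
/- For all integers m, n, t with m, n, t ≤ -1 and not all three equal to -1, and any solution (a, b, c) of the Q(m,n,t)-system in nonzero real numbers, each of a, b and c is irrational. -/
/-- The system is invariant under cyclic rotation. -/
theorem QSystem.rotate {m n t : ℤ} {a b c : ℝ} (h : QSystem m n t a b c) :
    QSystem n t m b c a :=
  ⟨h.2.1, h.2.2.1, h.1, h.2.2.2.2.1, h.2.2.2.2.2, h.2.2.2.1⟩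

/-- The product `w = abc` of a solution satisfies a monic reciprocal quadratic equation
with integer coefficients. -/
theorem QSystem.prod_sq_add_one {m n t : ℤ} {a b c : ℝ} (h : QSystem m n t a b c) :
    (a * b * c) ^ 2 + 1 =
      (((m - 1) * (n - 1) * (t - 1) - (m - 1) - (n - 1) - (t - 1) : ℤ) : ℝ) * (a * b * c) := by
  obtain ⟨ha, hb, hc, h1, h2, h3⟩ := h
  push_cast
  rw [← h1, ← h2, ← h3]
  field_simp
  ring

/-- For an integer `k ≤ -3`, the equation `w ^ 2 + 1 = k * w` has no rational solution. -/
theorem Rat.sq_add_one_ne_intCast_mul {k : ℤ} (hk : k ≤ -3) (w : ℚ) :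
    w ^ 2 + 1 ≠ (k : ℚ) * w := by
  intro hw
  have hsq : IsSquare ((k ^ 2 - 4 : ℤ) : ℚ) := ⟨2 * w - k, by push_cast; linear_combination -4 * hw⟩
  obtain ⟨s, hs⟩ := Rat.isSquare_intCast_iff.mp hsq
  have hs' : |s| * |s| = k ^ 2 - 4 := by rw [abs_mul_abs_self, hs]
  have hs0 := abs_nonneg s
  have hlt : |s| < -k := by nlinarith
  have hgt : -k - 1 < |s| := by nlinarith
  omega

theorem QSystem.irrational_fst {m n t : ℤ} (hm : m ≤ -1) (hn : n ≤ -1) (ht : t ≤ -1)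
    (hne : ¬(m = -1 ∧ n = -1 ∧ t = -1)) {a b c : ℝ} (h : QSystem m n t a b c) :
    Irrational a := by
  rintro ⟨q, rfl⟩
  have hprod := h.prod_sq_add_one
  obtain ⟨-, -, -, -, h2, h3⟩ := h
  obtain ⟨r, rfl⟩ : ∃ r : ℚ, (r : ℝ) = c :=
    ⟨t - 1 - 1 / q, by push_cast; linarith⟩
  obtain ⟨s, rfl⟩ : ∃ s : ℚ, (s : ℝ) = b :=
    ⟨n - 1 - 1 / r, by push_cast; linarith⟩
  refine Rat.sq_add_one_ne_intCast_mul ?_ (q * s * r) (by exact_mod_cast hprod)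
  obtain ⟨x, rfl⟩ : ∃ x, m = -1 - x := ⟨-1 - m, by ring⟩
  obtain ⟨y, rfl⟩ : ∃ y, n = -1 - y := ⟨-1 - n, by ring⟩
  obtain ⟨z, rfl⟩ : ∃ z, t = -1 - z := ⟨-1 - t, by ring⟩
  have hx0 : 0 ≤ x := by omega
  have hy0 : 0 ≤ y := by omega
  have hz0 : 0 ≤ z := by omega
  have hpos : 1 ≤ x + y + z := by omega
  have hxy := mul_nonneg hx0 hy0
  nlinarith [mul_nonneg hy0 hz0, mul_nonneg hx0 hz0, mul_nonneg hxy hz0]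

/-- For integers `m, n, t ≤ -1`, not all equal to `-1`, each coordinate of a solution
of the `Q(m,n,t)`-system is irrational. -/
theorem Q_system_solutions_irrational (m n t : ℤ) (hm : m ≤ -1) (hn : n ≤ -1) (ht : t ≤ -1)
    (hne : ¬(m = -1 ∧ n = -1 ∧ t = -1)) (a b c : ℝ) (h : QSystem m n t a b c) :
    Irrational a ∧ Irrational b ∧ Irrational c := by
  exact ⟨h.irrational_fst hm hn ht hne,
    h.rotate.irrational_fst hn ht hm (by tauto),
    h.rotate.rotate.irrational_fst ht hm hn (by tauto)⟩
end

section
/- For all integers m, n, t with m, n, t ≤ -1 and not all three equal to -1, and any solution (a, b, c) of the Q(m,n,t)-system in nonzero real numbers, the determinant of the Cartan matrix A(a,b,c) equals 1 + a*b*c and is nonzero; in particular A(a,b,c) has rank 3. -/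
/-- The Cartan matrix of the Dynkin diagram `Q^±(m,n,t)`. -/
def CartanQ (a b c : ℝ) : Matrix (Fin 3) (Fin 3) ℝ :=
  !![0, 1, a; b, 0, 1; 1, c, 0]

/-- A solution with `a * b * c = -1` forces a polynomial relation between `m`, `n` and `t`. -/
theorem QSystem.mul_eq_of_mul_eq_neg_one {m n t : ℤ} {a b c : ℝ} (h : QSystem m n t a b c)
    (habc : a * b * c = -1) :
    (m - 1) * (n - 1) * (t - 1) = (m - 1) + (n - 1) + (t - 1) - 2 := by
  obtain ⟨ha, hb, hc, hm, hn, ht⟩ := h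
  have ha' : 1 / a = -(b * c) := by
    rw [div_eq_iff ha]
    linarith
  have hb' : 1 / b = -(a * c) := by
    rw [div_eq_iff hb]
    linarith
  have hc' : 1 / c = -(a * b) := by
    rw [div_eq_iff hc]
    linarith
  rw [ha'] at ht
  rw [hb'] at hm
  rw [hc'] at hn
  have key : ((m : ℝ) - 1) * (n - 1) * (t - 1) = (m - 1) + (n - 1) + (t - 1) - 2 := by
    rw [← hm, ← hn, ← ht]
    linear_combination ((1 - a) * (1 - b) * (1 - c) + 1) * habc
  exact_mod_cast key

theorem eq_neg_one_of_mul_add_eq {m n t : ℤ} (hm : m ≤ -1) (hn : n ≤ -1) (ht : t ≤ -1)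
    (h : (m - 1) * (n - 1) * (t - 1) = (m - 1) + (n - 1) + (t - 1) - 2) :
    m = -1 ∧ n = -1 ∧ t = -1 := by
  obtain ⟨x, rfl⟩ : ∃ x, m = -1 - x := ⟨-1 - m, by ring⟩
  obtain ⟨y, rfl⟩ : ∃ y, n = -1 - y := ⟨-1 - n, by ring⟩
  obtain ⟨z, rfl⟩ : ∃ z, t = -1 - z := ⟨-1 - t, by ring⟩
  have hx : 0 ≤ x := by linarith
  have hy : 0 ≤ y := by linarith
  have hz : 0 ≤ z := by linarith
  have hxy := mul_nonneg hx hy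
  have hyz := mul_nonneg hy hz
  have hxz := mul_nonneg hx hz
  have hxyz := mul_nonneg hxy hz
  refine ⟨?_, ?_, ?_⟩ <;> nlinarith

/-- For integers `m, n, t ≤ -1`, not all equal to `-1`, and any solution `(a,b,c)` of the
`Q(m,n,t)`-system, the determinant of the Cartan matrix equals `1 + a*b*c` and is nonzero;
in particular the Cartan matrix has rank `3`. -/
theorem Q_Cartan_det (m n t : ℤ) (hm : m ≤ -1) (hn : n ≤ -1) (ht : t ≤ -1)
    (hne : ¬(m = -1 ∧ n = -1 ∧ t = -1)) (a b c : ℝ) (h : QSystem m n t a b c) :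
    (CartanQ a b c).det = 1 + a * b * c ∧ (CartanQ a b c).det ≠ 0 ∧
      (CartanQ a b c).rank = 3 := by
  have hdet : (CartanQ a b c).det = 1 + a * b * c := by
    simp [CartanQ, Matrix.det_fin_three]
  have hdet0 : (CartanQ a b c).det ≠ 0 := by
    rw [hdet]
    intro h0
    exact hne (eq_neg_one_of_mul_add_eq hm hn ht
      (h.mul_eq_of_mul_eq_neg_one (by linarith)))
  refine ⟨hdet, hdet0, ?_⟩
  simpa using Matrix.rank_of_isUnit _ ((Matrix.isUnit_iff_isUnit_det _).2 hdet0.isUnit)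
end

section
/- For all integers m, n, t with m, n, t ≤ -1 and not all three equal to -1, and any solution (a, b, c) of the Q(m,n,t)-system in nonzero real numbers, one has a*b*c ≠ 1. -/
/-- For integers `m, n, t ≤ -1`, not all equal to `-1`, and any solution `(a,b,c)` of the
`Q(m,n,t)`-system, one has `a*b*c ≠ 1`. -/
theorem Q_system_abc_ne_one (m n t : ℤ) (hm : m ≤ -1) (hn : n ≤ -1) (ht : t ≤ -1)
    (hne : ¬(m = -1 ∧ n = -1 ∧ t = -1)) (a b c : ℝ) (h : QSystem m n t a b c) :
    a * b * c ≠ 1 := by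
  obtain ⟨ha, hb, hc, h1, h2, h3⟩ := h
  intro habc
  have hprod : (a + 1 / b) * (b + 1 / c) * (c + 1 / a) =
      2 + (a + 1 / b) + (b + 1 / c) + (c + 1 / a) := by
    have expand : (a + 1 / b) * (b + 1 / c) * (c + 1 / a) =
        a * b * c + 1 / (a * b * c) + (a + 1 / b) + (b + 1 / c) + (c + 1 / a) := by
      field_simp
      ring
    rw [expand, habc]
    ring
  have hM : a + 1 / b = (m : ℝ) - 1 := by linarith
  have hN : b + 1 / c = (n : ℝ) - 1 := by linarith
  have hT : c + 1 / a = (t : ℝ) - 1 := by linarith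
  rw [hM, hN, hT] at hprod
  have hint : (m - 1) * (n - 1) * (t - 1) = 2 + (m - 1) + (n - 1) + (t - 1) := by
    exact_mod_cast hprod
  have hmn : 0 ≤ (-1 - m) * (-1 - n) := mul_nonneg (by linarith) (by linarith)
  have hnt : 0 ≤ (-1 - n) * (-1 - t) := mul_nonneg (by linarith) (by linarith)
  have hmt : 0 ≤ (-1 - m) * (-1 - t) := mul_nonneg (by linarith) (by linarith)
  have hmnt : 0 ≤ (-1 - m) * (-1 - n) * (-1 - t) := mul_nonneg hmn (by linarith)
  linarith
end

section
/- Let a, b, c be nonzero real numbers and let A(a,b,c) be the 3×3 real matrix with rows (0, 1, a), (b, 0, 1), (1, c, 0). There exists an invertible diagonal 3×3 real matrix D such that D * A(a,b,c) is symmetric if and only if a*b*c = 1. -/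
/-- For nonzero reals `a, b, c`, there exists an invertible diagonal `3×3` real matrix `D`
such that `D * A(a,b,c)` is symmetric if and only if `a*b*c = 1`. -/
theorem CartanQ_symmetrizable_iff (a b c : ℝ) (ha : a ≠ 0) (hb : b ≠ 0) (hc : c ≠ 0) :
    (∃ D : Matrix (Fin 3) (Fin 3) ℝ, D.IsDiag ∧ IsUnit D ∧ (D * CartanQ a b c).IsSymm) ↔
      a * b * c = 1 := by
  constructor
  · rintro ⟨D, hD, hU, hS⟩
    obtain ⟨d, rfl⟩ : ∃ d, Matrix.diagonal d = D := ⟨D.diag, hD.diagonal_diag⟩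
    have h0 : d 0 ≠ 0 := (Pi.isUnit_iff.mp (Matrix.isUnit_diagonal.mp hU) 0).ne_zero
    have h01 := hS.apply 0 1
    have h02 := hS.apply 0 2
    have h12 := hS.apply 1 2
    simp [CartanQ, Matrix.diagonal_mul] at h01 h02 h12
    apply mul_left_cancel₀ h0
    linear_combination h01 + b * h12 - b * c * h02
  · intro h
    refine ⟨Matrix.diagonal ![1, a * c, a], Matrix.isDiag_diagonal _, ?_, ?_⟩
    · rw [Matrix.isUnit_diagonal, Pi.isUnit_iff]
      intro i
      fin_cases i <;> simp [ha, hc]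
    · refine Matrix.IsSymm.ext fun i j => ?_
      fin_cases i <;> fin_cases j <;> simp [CartanQ, Matrix.diagonal_mul] <;>
        linarith
end

section
/- Let A be an n×n matrix over ℂ, and let k be an index such that A k k = 0 and such that for every index i, A i k = 0 if and only if A k i = 0 (the regularity condition at k). Define the odd reflection r_k(A) = A' by: A' k j = A k j for all j; A' i k = -(A k i)*(A i k) for i ≠ k; and for i ≠ k, j ≠ k: A' i j = A i j if A i k = 0, A' i j = (A k i)*(A i j) if A i k ≠ 0 and A k j = 0, and A' i j = (A k i)*(A i j) + (A i k)*(A k j) + (A k i)*(A i k) if A i k ≠ 0 and A k j ≠ 0. Then: (i) A' k k = 0 and A' again satisfies the regularity condition at k; and (ii) r_k(r_k(A)) = D*A, where D is the invertible diagonal matrix with D k k = 1, D i i = 1 for every i with A i k = 0, and D i i = (A k i)^2 for every i ≠ k with A i k ≠ 0. In particular, the odd reflection at a regular isotropic simple root is an involution up to rescaling of rows. -/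
open scoped Classical

/-- The odd reflection `r_k(A)` of an `n×n` complex matrix `A` at an index `k`
(with `A k k = 0`), given by the formulas for reflecting the Cartan matrix of a
contragredient Lie superalgebra at a regular isotropic simple root `α_k`. -/
noncomputable def oddReflection {n : ℕ} (A : Matrix (Fin n) (Fin n) ℂ) (k : Fin n) :
    Matrix (Fin n) (Fin n) ℂ :=
  Matrix.of fun i j =>
    if i = k then A k j
    else if j = k then -(A k i) * (A i k)
    else if A i k = 0 then A i j
    else if A k j = 0 then A k i * A i j
    else A k i * A i j + A i k * A k j + A k i * A i k

/-- The odd reflection at a regular isotropic simple root preserves isotropy and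
regularity at `k`, and applying it twice gives back `A` up to rescaling of rows by the
invertible diagonal matrix `D` with `D k k = 1`, `D i i = 1` when `A i k = 0`, and
`D i i = (A k i)^2` when `i ≠ k` and `A i k ≠ 0`. -/
theorem oddReflection_involutive {n : ℕ} (A : Matrix (Fin n) (Fin n) ℂ) (k : Fin n)
    (hkk : A k k = 0) (hreg : ∀ i, A i k = 0 ↔ A k i = 0) :
    (oddReflection A k k k = 0 ∧
      ∀ i, oddReflection A k i k = 0 ↔ oddReflection A k k i = 0) ∧
    oddReflection (oddReflection A k) k =
      Matrix.diagonal (fun i => if A i k = 0 then (1 : ℂ) else (A k i) ^ 2) * A ∧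
    IsUnit (Matrix.diagonal (fun i => if A i k = 0 then (1 : ℂ) else (A k i) ^ 2)).det := by
  refine ⟨⟨by simp [oddReflection, hkk], fun i => ?_⟩, ?_, ?_⟩
  · by_cases hi : i = k <;> simp [oddReflection, hi, hkk, hreg]
  · ext i j
    rw [Matrix.diagonal_mul]
    by_cases hi : i = k
    · subst hi
      simp [oddReflection, hkk]
    by_cases hA : A i k = 0
    · have hA' := (hreg i).1 hA
      by_cases hj : j = k
      · subst hj
        simp [oddReflection, hi, hA]
      · simp [oddReflection, hi, hj, hA, hA']
    · have hA' : A k i ≠ 0 := fun h => hA ((hreg i).2 h)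
      by_cases hj : j = k
      · subst hj
        simp [oddReflection, hi, hA]
        ring
      · by_cases hc : A k j = 0
        · simp [oddReflection, hi, hj, hA, hA', hc]
          ring
        · simp [oddReflection, hi, hj, hA, hA', hc]
          ring
  · rw [Matrix.det_diagonal, isUnit_iff_ne_zero, Finset.prod_ne_zero_iff]
    intro i _
    split_ifs with h
    · exact one_ne_zero
    · exact pow_ne_zero 2 fun h' => h ((hreg i).2 h')
end

section
/- For all integers m, n, t with m, n, t ≤ -1 and not all three equal to -1, the symmetric real 3×3 matrix with rows (2*n*t, m*n*t, m*n*t), (m*n*t, 2*m*t, m*n*t), (m*n*t, m*n*t, 2*m*n) — i.e. the symmetrization D*B of the matrix B with rows (2, m, m), (n, 2, n), (t, t, 2) by the invertible diagonal matrix D = diag(n*t, m*t, m*n) — is not positive semidefinite. (Consequently B is a generalized Cartan matrix of indefinite type, so it is not the Cartan matrix of a finite-growth Kac–Moody algebra, which is the key step showing that the superalgebras Q^±(m,n,t) do not have finite growth.) -/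
/-- For integers `m, n, t ≤ -1`, not all equal to `-1`, the symmetrization
`D * B` of the matrix `B` of pairings of the principal roots of `Q^±(m,n,t)`,
where `B` has rows `(2, m, m), (n, 2, n), (t, t, 2)` and `D = diag(n*t, m*t, m*n)`,
is not positive semidefinite.  Consequently `B` is a generalized Cartan matrix of
indefinite type, hence not the Cartan matrix of a finite-growth Kac–Moody algebra. -/
theorem Q_principal_symmetrization_not_posSemidef (m n t : ℤ)
    (hm : m ≤ -1) (hn : n ≤ -1) (ht : t ≤ -1) (hne : ¬(m = -1 ∧ n = -1 ∧ t = -1)) :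
    (!![2 * (n : ℝ) * t, (m : ℝ) * n * t, (m : ℝ) * n * t;
        (m : ℝ) * n * t, 2 * (m : ℝ) * t, (m : ℝ) * n * t;
        (m : ℝ) * n * t, (m : ℝ) * n * t, 2 * (m : ℝ) * n] =
      Matrix.diagonal ![(n : ℝ) * t, (m : ℝ) * t, (m : ℝ) * n] *
        !![(2 : ℝ), (m : ℝ), (m : ℝ); (n : ℝ), 2, (n : ℝ); (t : ℝ), (t : ℝ), 2]) ∧
    IsUnit (Matrix.diagonal ![(n : ℝ) * t, (m : ℝ) * t, (m : ℝ) * n]) ∧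
    ¬ (!![2 * (n : ℝ) * t, (m : ℝ) * n * t, (m : ℝ) * n * t;
          (m : ℝ) * n * t, 2 * (m : ℝ) * t, (m : ℝ) * n * t;
          (m : ℝ) * n * t, (m : ℝ) * n * t, 2 * (m : ℝ) * n]).PosSemidef := by
  have hm' : (m : ℝ) ≤ -1 := mod_cast hm
  have hn' : (n : ℝ) ≤ -1 := mod_cast hn
  have ht' : (t : ℝ) ≤ -1 := mod_cast ht
  refine ⟨?_, ?_, fun h => ?_⟩
  · ext i j
    fin_cases i <;> fin_cases j <;> simp [Matrix.diagonal_mul] <;> ring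
  · have hm0 : (m : ℝ) ≠ 0 := by linarith
    have hn0 : (n : ℝ) ≠ 0 := by linarith
    have ht0 : (t : ℝ) ≠ 0 := by linarith
    rw [Matrix.isUnit_iff_isUnit_det, Matrix.det_diagonal, isUnit_iff_ne_zero]
    simp [Fin.prod_univ_three, hm0, hn0, ht0]
  · -- The all-ones vector has negative square.
    have hq := h.dotProduct_mulVec_nonneg ![1, 1, 1]
    simp [Matrix.mulVec, dotProduct, Fin.sum_univ_three] at hq
    have hZ : 0 ≤ n * t * (1 + m) + m * t * (1 + n) + m * n * (1 + t) := by
      have : (0 : ℝ) ≤ n * t * (1 + m) + m * t * (1 + n) + m * n * (1 + t) := by linarith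
      exact_mod_cast this
    have hnt : 0 < n * t := by nlinarith
    have hmt : 0 < m * t := by nlinarith
    have hmn : 0 < m * n := by nlinarith
    have h₁ : n * t * (1 + m) ≤ 0 := mul_nonpos_of_nonneg_of_nonpos hnt.le (by linarith)
    have h₂ : m * t * (1 + n) ≤ 0 := mul_nonpos_of_nonneg_of_nonpos hmt.le (by linarith)
    have h₃ : m * n * (1 + t) ≤ 0 := mul_nonpos_of_nonneg_of_nonpos hmn.le (by linarith)
    have e₁ := (mul_eq_zero.mp (by linarith : n * t * (1 + m) = 0)).resolve_left hnt.ne'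
    have e₂ := (mul_eq_zero.mp (by linarith : m * t * (1 + n) = 0)).resolve_left hmt.ne'
    have e₃ := (mul_eq_zero.mp (by linarith : m * n * (1 + t) = 0)).resolve_left hmn.ne'
    exact hne ⟨by linarith, by linarith, by linarith⟩
end
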